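/- arXiv:1111.2508 — 2 statements merged into one kernel-verified Lean document; each statement's English description precedes it below -/
import Mathlib

section
/- Let W be the loop polynomial W = Σ_{i=1}^N X_i^{a_i} X_{i+1} (indices mod N) with N even. Then in the Milnor ring Q_W the following two identities hold: the image of ∏_{i odd} X_i^{2a_i − 2} equals (∏_{i even} (−a_i)) times the image of ∏_{i=1}^N X_i^{a_i − 1}, and the image of ∏_{i even} X_i^{2a_i − 2} equals (∏_{i odd} (−a_i)) times the image of ∏_{i=1}^N X_i^{a_i − 1}. -/
open MvPolynomial

/-- The loop polynomial `W = ∑ i, X i ^ a i * X (i+1)` (indices mod `N`). -/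
noncomputable def loopW (N : ℕ) [NeZero N] (a : Fin N → ℕ) : MvPolynomial (Fin N) ℂ :=
  ∑ i : Fin N, X i ^ a i * X (i + 1)

/-- The Jacobian ideal of `W`, generated by the partial derivatives. -/
noncomputable def jacIdeal {N : ℕ} (W : MvPolynomial (Fin N) ℂ) :
    Ideal (MvPolynomial (Fin N) ℂ) :=
  Ideal.span (Set.range fun i => pderiv i W)

/-- If `Q (i + 1) ↔ P i` for all `i`, then shifting the index by one turns a product over the
indices satisfying `P` into a product over those satisfying `Q`. -/
theorem prod_filter_shift {N : ℕ} [NeZero N] {R : Type*} [CommMonoid R]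
    (P Q : Fin N → Prop) [DecidablePred P] [DecidablePred Q]
    (h : ∀ i, Q (i + 1) ↔ P i) (f : Fin N → R) :
    ∏ i ∈ Finset.univ.filter P, f (i + 1) = ∏ i ∈ Finset.univ.filter Q, f i := by
  rw [Finset.prod_filter, Finset.prod_filter,
    ← Equiv.prod_comp (Equiv.addRight (1 : Fin N)) (fun i => if Q i then f i else 1)]
  simp [h]

/-- Cyclic relations `x i ^ a i = c (i+1) * x (i+1) ^ (a (i+1) - 1) * x (i+2)` multiply up to a
relation between the product over an alternating set of indices and the full product. -/
theorem prod_pow_of_cyclic_relations {N : ℕ} [NeZero N] {R : Type*} [CommRing R]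
    (a : Fin N → ℕ) (ha : ∀ i, 2 ≤ a i) (x c : Fin N → R)
    (hx : ∀ i, x i ^ a i = c (i + 1) * x (i + 1) ^ (a (i + 1) - 1) * x (i + 1 + 1))
    (P : Fin N → Prop) [DecidablePred P] (hP : ∀ i, P (i + 1) ↔ ¬ P i) :
    ∏ i ∈ Finset.univ.filter P, x i ^ (2 * a i - 2) =
      (∏ i ∈ Finset.univ.filter (fun i => ¬ P i), c i) * ∏ i, x i ^ (a i - 1) := by
  have hsplit : ∀ i, x i ^ (2 * a i - 2) = x i ^ a i * x i ^ (a i - 2) := fun i => by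
    rw [← pow_add]; congr 1; have := ha i; omega
  have hsucc : ∀ i, x i * x i ^ (a i - 2) = x i ^ (a i - 1) := fun i => by
    rw [← pow_succ']; congr 1; have := ha i; omega
  have hPn : ∀ i, ¬ P (i + 1) ↔ P i := fun i => by rw [hP, not_not]
  rw [Finset.prod_congr rfl fun i _ => hsplit i, Finset.prod_mul_distrib,
    Finset.prod_congr rfl fun i _ => hx i,
    prod_filter_shift P (fun i => ¬ P i) hPn (fun i => c i * x i ^ (a i - 1) * x (i + 1)),
    Finset.prod_mul_distrib, Finset.prod_mul_distrib,
    prod_filter_shift (fun i => ¬ P i) P hP x, mul_assoc,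
    ← Finset.prod_mul_distrib (f := x),
    Finset.prod_congr rfl fun i _ => hsucc i, mul_assoc, mul_comm (∏ i with ¬ P i, x i ^ _),
    Finset.prod_filter_mul_prod_filter_not]

theorem Fin.even_val_add_one {N : ℕ} [NeZero N] (hN : Even N) (i : Fin N) :
    Even ((i + 1 : Fin N) : ℕ) ↔ ¬ Even (i : ℕ) := by
  have h2 : 2 ∣ N := hN.two_dvd
  rw [Fin.val_add, Fin.val_one', Nat.add_mod_mod, Nat.even_iff,
    Nat.mod_mod_of_dvd _ h2, ← Nat.even_iff, Nat.even_add_one]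

theorem pderiv_loopW {N : ℕ} [NeZero N] (a : Fin N → ℕ) (i : Fin N) :
    pderiv (i + 1) (loopW N a) =
      X i ^ a i + C (a (i + 1) : ℂ) * X (i + 1) ^ (a (i + 1) - 1) * X (i + 1 + 1) := by
  simp only [loopW, map_sum, Derivation.leibniz, Derivation.leibniz_pow, pderiv_X,
    Finset.sum_add_distrib, smul_eq_mul, nsmul_eq_mul, Pi.single_apply, add_left_inj]
  simp [mul_comm, mul_left_comm]

theorem loopW_milnor_relation {N : ℕ} [NeZero N] (a : Fin N → ℕ) (i : Fin N) :
    Ideal.Quotient.mk (jacIdeal (loopW N a)) (X i) ^ a i =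
      algebraMap ℂ _ (-(a (i + 1) : ℂ)) *
        Ideal.Quotient.mk (jacIdeal (loopW N a)) (X (i + 1)) ^ (a (i + 1) - 1) *
          Ideal.Quotient.mk (jacIdeal (loopW N a)) (X (i + 1 + 1)) := by
  have h : Ideal.Quotient.mk (jacIdeal (loopW N a)) (pderiv (i + 1) (loopW N a)) = 0 :=
    Ideal.Quotient.eq_zero_iff_mem.2 (Ideal.subset_span ⟨i + 1, rfl⟩)
  rw [pderiv_loopW] at h
  simp only [map_add, map_mul, map_pow, map_natCast] at h
  rw [map_neg, map_natCast]
  linear_combination h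

/-- For an even-variable loop polynomial, in the Milnor ring we have
`∏_{i odd} X i ^ (2 a i - 2) = (∏_{i even} (-a i)) ∏ i X i ^ (a i - 1)` and
`∏_{i even} X i ^ (2 a i - 2) = (∏_{i odd} (-a i)) ∏ i X i ^ (a i - 1)`.
(Indices here are zero-based, so the one-based index `i+1` is odd exactly when
`(i : ℕ)` is even.) -/
theorem loop_even_relations (N : ℕ) [NeZero N] (hN : 2 ≤ N) (hNeven : Even N)
    (a : Fin N → ℕ) (ha : ∀ i, 2 ≤ a i) :
    (Ideal.Quotient.mk (jacIdeal (loopW N a))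
        (∏ i ∈ Finset.univ.filter (fun i : Fin N => Even (i : ℕ)), X i ^ (2 * a i - 2)) =
      (∏ i ∈ Finset.univ.filter (fun i : Fin N => ¬ Even (i : ℕ)), (-(a i : ℂ))) •
        Ideal.Quotient.mk (jacIdeal (loopW N a)) (∏ i : Fin N, X i ^ (a i - 1))) ∧
    (Ideal.Quotient.mk (jacIdeal (loopW N a))
        (∏ i ∈ Finset.univ.filter (fun i : Fin N => ¬ Even (i : ℕ)), X i ^ (2 * a i - 2)) =
      (∏ i ∈ Finset.univ.filter (fun i : Fin N => Even (i : ℕ)), (-(a i : ℂ))) •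
        Ideal.Quotient.mk (jacIdeal (loopW N a)) (∏ i : Fin N, X i ^ (a i - 1))) := by
  have key := prod_pow_of_cyclic_relations a ha
    (fun i => Ideal.Quotient.mk (jacIdeal (loopW N a)) (X i)) (fun i => algebraMap ℂ _ (-(a i : ℂ)))
    (loopW_milnor_relation a)
  have hEven := Fin.even_val_add_one hNeven
  have hsmul : ∀ (c : ℂ) (p : MvPolynomial (Fin N) ℂ),
      c • Ideal.Quotient.mk (jacIdeal (loopW N a)) p =
        algebraMap ℂ _ c * Ideal.Quotient.mk (jacIdeal (loopW N a)) p :=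
    fun c p => Algebra.smul_def c (Ideal.Quotient.mk (jacIdeal (loopW N a)) p)
  rw [hsmul, hsmul]
  simp only [map_prod, map_pow]
  refine ⟨key (fun i => Even (i : ℕ)) hEven, ?_⟩
  simpa only [not_not] using key (fun i => ¬ Even (i : ℕ)) fun i => not_congr (hEven i)
end

section
/- Let M be the exponent matrix of the loop polynomial with exponents a_1, …, a_N. Suppose r, r′ ∈ ℤ^N satisfy 0 ≤ r_i ≤ a_i − 1 and 0 ≤ r′_i ≤ a_i − 1 for all i, the vector M⁻¹(r + 𝟙) does not have all entries in ℤ (where 𝟙 = (1, …, 1)ᵀ), and M⁻¹(r − r′) has all entries in ℤ. Then r = r′. -/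
/-- The exponent matrix (over `ℚ`) of the loop polynomial with exponents `a`:
`M i i = a i`, `M i (i+1) = 1` (indices mod `N`), all other entries `0`. -/
def loopMatrixQ (N : ℕ) [NeZero N] (a : Fin N → ℤ) : Matrix (Fin N) (Fin N) ℚ :=
  Matrix.of fun i j => if j = i then (a i : ℚ) else if j = i + 1 then 1 else 0

/-- A predicate on `Fin N` stable under the cyclic successor holds everywhere once it holds
somewhere. -/
theorem Fin.forall_of_cyclic_succ {N : ℕ} [NeZero N] {P : Fin N → Prop}
    (hsucc : ∀ i, P i → P (i + 1)) {i : Fin N} (hi : P i) (j : Fin N) : P j := by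
  open Fin.CommRing in
  have key : ∀ k : ℕ, P (i + (k : Fin N)) := by
    intro k
    induction k with
    | zero => simpa using hi
    | succ k ih =>
      have h := hsucc _ ih
      rwa [add_assoc, ← Nat.cast_succ] at h
  have h := key (j - i).val
  rwa [Fin.cast_val_eq_self, add_sub_cancel] at h

theorem loopMatrixQ_mulVec {N : ℕ} [NeZero N] (hN : 2 ≤ N) (a : Fin N → ℤ) (v : Fin N → ℚ)
    (i : Fin N) : (loopMatrixQ N a).mulVec v i = a i * v i + v (i + 1) := by
  have hne : i + 1 ≠ i := by
    simp only [ne_eq, add_eq_left, Fin.one_eq_zero_iff]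
    omega
  have hsplit : ∀ j, (if j = i then (a i : ℚ) else if j = i + 1 then 1 else 0) * v j
      = (if j = i then (a i : ℚ) * v j else 0) + (if j = i + 1 then v j else 0) := by
    intro j
    by_cases h : j = i
    · subst h
      simp [hne.symm]
    · simp [h]
  simp [Matrix.mulVec, dotProduct, loopMatrixQ, hsplit, Finset.sum_add_distrib]

theorem isUnit_loopMatrixQ {N : ℕ} [NeZero N] (hN : 2 ≤ N) {a : Fin N → ℤ}
    (ha : ∀ i, 2 ≤ a i) : IsUnit (loopMatrixQ N a) := by
  rw [← Matrix.mulVec_injective_iff_isUnit]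
  refine (injective_iff_map_eq_zero (loopMatrixQ N a).mulVecLin).mpr fun v hv => ?_
  obtain ⟨i, hi⟩ := Finite.exists_max fun j => |v j|
  have h := congrFun hv i
  rw [Matrix.mulVecLin_apply, loopMatrixQ_mulVec hN, Pi.zero_apply] at h
  have ha' : (2 : ℚ) ≤ a i := by exact_mod_cast ha i
  have habs : (a i : ℚ) * |v i| = |v (i + 1)| := by
    rw [eq_neg_of_add_eq_zero_right h, abs_neg, abs_mul, abs_of_pos (by linarith : (0 : ℚ) < a i)]
  have hzero : |v i| ≤ 0 := by nlinarith [hi (i + 1), abs_nonneg (v i)]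
  funext j
  exact abs_nonpos_iff.mp ((hi j).trans hzero)

/-- An integral solution of `M z = d` with `|d i| ≤ a i - 1` has all entries of absolute value
at most `1`. -/
theorem abs_le_one_of_loop_system {N : ℕ} [NeZero N] {a d z : Fin N → ℤ} (ha : ∀ i, 2 ≤ a i)
    (hd : ∀ i, |d i| ≤ a i - 1) (hz : ∀ i, a i * z i + z (i + 1) = d i) (i : Fin N) :
    |z i| ≤ 1 := by
  obtain ⟨k, hk⟩ := Finite.exists_max fun j => |z j|
  refine (hk i).trans ?_
  have hak := ha k
  have h : a k * |z k| ≤ |d k| + |z (k + 1)| := by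
    have hmul : |a k * z k| = a k * |z k| := by
      rw [abs_mul, abs_of_pos (by linarith : 0 < a k)]
    rw [← hmul, eq_sub_of_add_eq (hz k)]
    exact abs_sub _ _
  nlinarith [hd k, hk (k + 1)]

/-- Uniqueness of the representation `M⁻¹ (r + 𝟙)` (mod `ℤ^N`) of a nontrivial
diagonal symmetry of the loop polynomial: if `0 ≤ r i, r' i ≤ a i - 1`, the vector
`M⁻¹ (r + 𝟙)` is not integral, and `M⁻¹ (r - r')` is integral, then `r = r'`. -/
theorem loop_symmetry_unique (N : ℕ) [NeZero N] (hN : 2 ≤ N) (a : Fin N → ℤ)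
    (ha : ∀ i, 2 ≤ a i) (r r' : Fin N → ℤ)
    (hr : ∀ i, 0 ≤ r i ∧ r i ≤ a i - 1) (hr' : ∀ i, 0 ≤ r' i ∧ r' i ≤ a i - 1)
    (hnontriv : ¬ ∀ i : Fin N, ∃ z : ℤ,
      ((loopMatrixQ N a)⁻¹.mulVec (fun j => (r j : ℚ) + 1)) i = z)
    (hdiff : ∀ i : Fin N, ∃ z : ℤ,
      ((loopMatrixQ N a)⁻¹.mulVec (fun j => (r j : ℚ) - r' j)) i = z) :
    r = r' := by
  have hunit := (Matrix.isUnit_iff_isUnit_det _).mp (isUnit_loopMatrixQ hN ha)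
  choose z hz using hdiff
  have hsys : ∀ i, a i * z i + z (i + 1) = r i - r' i := by
    intro i
    have h := loopMatrixQ_mulVec hN a (fun j => (z j : ℚ)) i
    rw [← funext hz, Matrix.mulVec_mulVec, Matrix.mul_nonsing_inv _ hunit, Matrix.one_mulVec] at h
    exact_mod_cast h.symm
  have hbound : ∀ i, |z i| ≤ 1 := abs_le_one_of_loop_system ha
    (fun i => abs_le.mpr ⟨by linarith [(hr i).1, (hr' i).2], by linarith [(hr i).2, (hr' i).1]⟩)
    hsys
  by_cases hzero : ∀ i, z i = 0
  · funext i
    have h := hsys i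
    simp only [hzero, mul_zero, add_zero] at h
    linarith
  obtain ⟨k, hk⟩ := not_forall.mp hzero
  have hcases : ∀ i, z i ≠ 0 → z i = 1 ∧ z (i + 1) = -1 ∧ r i = a i - 1 ∨
      z i = -1 ∧ z (i + 1) = 1 ∧ r i = 0 := by
    intro i hi
    have hi1 := abs_le.mp (hbound i)
    have hi2 := abs_le.mp (hbound (i + 1))
    have hs := hsys i
    have h1 := hr i
    have h2 := hr' i
    obtain h | h : z i = 1 ∨ z i = -1 := by omega
    · rw [h] at hs
      left
      omega
    · rw [h] at hs
      right
      omega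
  have hne : ∀ i, z i ≠ 0 := Fin.forall_of_cyclic_succ (fun i hi => by
    rcases hcases i hi with h | h <;> simp [h.2.1]) hk
  refine absurd (fun i => ⟨if z i = 1 then 1 else 0, ?_⟩) hnontriv
  have hvec : (fun j => (r j : ℚ) + 1) =
      (loopMatrixQ N a).mulVec fun j => ((if z j = 1 then 1 else 0 : ℤ) : ℚ) := by
    funext j
    rw [loopMatrixQ_mulVec hN]
    rcases hcases j (hne j) with ⟨h1, h2, h3⟩ | ⟨h1, h2, h3⟩ <;> simp [h1, h2, h3]
  rw [hvec, Matrix.mulVec_mulVec, Matrix.nonsing_inv_mul _ hunit, Matrix.one_mulVec]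
end
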